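/- Let R be a Noetherian commutative local ring that is complete with respect to its maximal ideal (i.e., R is m_R-adically complete), and let A be an R-algebra that is finitely generated as an R-module. Let m be a maximal two-sided ideal of A. Then there exists an idempotent for (A, m), i.e., an element e ∈ A with e² = e, e ∉ m, and e ∈ m' for every maximal two-sided ideal m' of A with m' ≠ m. -/

import Mathlib

/-- A subset `I` of a ring `B` is a two-sided ideal: it contains `0`, is closed under
addition, and is closed under multiplication by arbitrary ring elements on both sides. -/
def IsTwoSidedIdealSet {B : Type*} [Ring B] (I : Set B) : Prop :=
  (0 : B) ∈ I ∧ (∀ a ∈ I, ∀ b ∈ I, a + b ∈ I) ∧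
    (∀ (x : B), ∀ a ∈ I, x * a ∈ I) ∧ (∀ (x : B), ∀ a ∈ I, a * x ∈ I)

/-- A subset `I` of a ring `B` is a maximal two-sided ideal: it is a proper two-sided
ideal which is maximal among proper two-sided ideals. -/
def IsMaximalTwoSidedIdeal {B : Type*} [Ring B] (I : Set B) : Prop :=
  IsTwoSidedIdealSet I ∧ I ≠ Set.univ ∧
    ∀ J : Set B, IsTwoSidedIdealSet J → J ≠ Set.univ → I ⊆ J → J = I

section Helpers

open IsLocalRing

theorem aux_precomplete {R M : Type*} [CommRing R] (I : Ideal R) [IsAdicComplete I R]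
    [AddCommGroup M] [Module R M] [Module.Finite R M] : IsPrecomplete I M := by
  rw [← AdicCompletion.of_surjective_iff]
  intro y
  obtain ⟨t, rfl⟩ := AdicCompletion.ofTensorProduct_surjective_of_finite I M y
  induction t with
  | zero => exact ⟨0, by simp⟩
  | add a b ha hb =>
    obtain ⟨a', ha⟩ := ha
    obtain ⟨b', hb⟩ := hb
    exact ⟨a' + b', by rw [map_add, map_add, ha, hb]⟩
  | tmul r x =>
    obtain ⟨s, rfl⟩ := AdicCompletion.of_surjective I R r
    refine ⟨s • x, ?_⟩
    rw [AdicCompletion.ofTensorProduct_tmul, map_smul]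
    ext n
    rfl

theorem aux_mul_mem {R A : Type*} [CommRing R] [Ring A] [Algebra R A] (I J : Ideal R)
    {a b : A} (ha : a ∈ (I • ⊤ : Submodule R A)) (hb : b ∈ (J • ⊤ : Submodule R A)) :
    a * b ∈ ((I * J) • ⊤ : Submodule R A) := by
  induction ha using Submodule.smul_induction_on' with
  | smul r hr x _ =>
    induction hb using Submodule.smul_induction_on' with
    | smul s hs y _ =>
      rw [smul_mul_smul_comm]
      exact Submodule.smul_mem_smul (Ideal.mul_mem_mul hr hs) trivial
    | add y _ z _ hy hz => rw [mul_add]; exact add_mem hy hz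
  | add y _ z _ hy hz => rw [add_mul]; exact add_mem hy hz

theorem aux_mul_mem_left {R A : Type*} [CommRing R] [Ring A] [Algebra R A] (I : Ideal R)
    (a : A) {b : A} (hb : b ∈ (I • ⊤ : Submodule R A)) :
    a * b ∈ (I • ⊤ : Submodule R A) := by
  have := aux_mul_mem ⊤ I (a := a) (by simp) hb
  simpa using this

theorem aux_mul_mem_right {R A : Type*} [CommRing R] [Ring A] [Algebra R A] (I : Ideal R)
    (a : A) {b : A} (hb : b ∈ (I • ⊤ : Submodule R A)) :
    b * a ∈ (I • ⊤ : Submodule R A) := by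
  have := aux_mul_mem I ⊤ (b := a) hb (by simp)
  simpa using this

theorem aux_lift {R A : Type*} [CommRing R] [IsLocalRing R] [IsNoetherianRing R]
    [IsAdicComplete (maximalIdeal R) R] [Ring A] [Algebra R A] [Module.Finite R A]
    (a : A) (ha : a * a - a ∈ (maximalIdeal R • ⊤ : Submodule R A)) :
    ∃ e : A, e * e = e ∧ a - e ∈ (maximalIdeal R • ⊤ : Submodule R A) := by
  set I := maximalIdeal R with hI
  have hP : IsPrecomplete I A := aux_precomplete I
  have hH : IsHausdorff I A := inferInstance
  let step : A → A := fun e => 3 * e * e - 2 * e * e * e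
  let f : ℕ → A := fun n => step^[n] a
  have hf0 : f 0 = a := rfl
  have hfs : ∀ n, f (n + 1) = step (f n) := fun n => Function.iterate_succ_apply' step n a
  have anti : ∀ m n, m ≤ n → (I ^ n • ⊤ : Submodule R A) ≤ I ^ m • ⊤ := fun m n h =>
    Submodule.smul_mono_left (Ideal.pow_le_pow_right h)
  have h1 : ∀ n, f n * f n - f n ∈ (I ^ (n + 1) • ⊤ : Submodule R A) := by
    intro n
    induction n with
    | zero => simpa [hf0] using ha
    | succ n ih =>
      have e1 : f (n+1) * f (n+1) - f (n+1) =
          ((f n * f n - f n) * (f n * f n - f n)) * (4 * f n * f n - 4 * f n - 3) := by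
        rw [hfs]; simp only [step]; noncomm_ring
      rw [e1]
      apply aux_mul_mem_right
      have := aux_mul_mem _ _ ih ih
      rw [← pow_add] at this
      exact anti _ _ (by omega) this
  have h2 : ∀ n, f (n + 1) - f n ∈ (I ^ (n + 1) • ⊤ : Submodule R A) := by
    intro n
    have e1 : f (n+1) - f n = (1 - 2 * f n) * (f n * f n - f n) := by
      rw [hfs]; simp only [step]; noncomm_ring
    rw [e1]
    exact aux_mul_mem_left _ _ (h1 n)
  have h3 : ∀ m n, m ≤ n → f n - f m ∈ (I ^ m • ⊤ : Submodule R A) := by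
    intro m n h
    induction n, h using Nat.le_induction with
    | base => simp
    | succ n hmn ih =>
      have := add_mem (anti m (n+1) (by omega) (h2 n)) ih
      simpa using this
  obtain ⟨L, hL⟩ := hP.prec' f (fun {m n} h => by
    rw [SModEq.sub_mem, ← neg_mem_iff, neg_sub]; exact h3 m n h)
  simp only [SModEq.sub_mem] at hL
  refine ⟨L, ?_, ?_⟩
  · rw [← sub_eq_zero]
    apply hH.haus'
    intro n
    rw [SModEq.zero]
    have e1 : L * L - L = (f n * f n - f n) - ((f n - L) * f n + L * (f n - L) - (f n - L)) := by
      noncomm_ring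
    rw [e1]
    refine sub_mem (anti n (n+1) (by omega) (h1 n)) (sub_mem (add_mem ?_ ?_) (hL n))
    · exact aux_mul_mem_right _ _ (hL n)
    · exact aux_mul_mem_left _ _ (hL n)
  · have a1 := hL 1
    have a2 := h2 0
    rw [zero_add, pow_one] at a2
    rw [pow_one] at a1
    have := sub_mem a1 a2
    rw [hf0] at this
    simpa using this

theorem aux_one_notMem {B : Type*} [Ring B] {m : Set B} (h : IsTwoSidedIdealSet m)
    (h' : m ≠ Set.univ) : (1 : B) ∉ m := fun h1 =>
  h' (Set.eq_univ_of_forall fun x => by simpa using h.2.2.1 x 1 h1)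

/-- The `R`-submodule underlying a two-sided ideal. -/
def auxSub (R : Type*) {A : Type*} [CommRing R] [Ring A] [Algebra R A] (m : Set A)
    (h : IsTwoSidedIdealSet m) : Submodule R A where
  carrier := m
  zero_mem' := h.1
  add_mem' {a b} ha hb := h.2.1 a ha b hb
  smul_mem' r a ha := by rw [Algebra.smul_def]; exact h.2.2.1 _ a ha

theorem aux_sum {R A : Type*} [CommRing R] [Ring A] [Algebra R A] {m : Set A}
    (hm : IsMaximalTwoSidedIdeal m) (J : Submodule R A) (hJ : IsTwoSidedIdealSet (J : Set A))
    (h : ¬ (J : Set A) ⊆ m) : auxSub R m hm.1 ⊔ J = ⊤ := by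
  by_contra hne
  apply h
  have key := hm.2.2 ((auxSub R m hm.1 ⊔ J : Submodule R A) : Set A) ?_ ?_ ?_
  · intro x hx
    rw [← key]
    exact Submodule.mem_sup_right (T := J) hx
  · refine ⟨zero_mem _, fun a ha b hb => add_mem ha hb, ?_, ?_⟩
    · intro x a ha
      obtain ⟨u, hu, v, hv, rfl⟩ := Submodule.mem_sup.1 ha
      rw [mul_add]
      exact add_mem (Submodule.mem_sup_left (hm.1.2.2.1 x u hu))
        (Submodule.mem_sup_right (hJ.2.2.1 x v hv))
    · intro x a ha
      obtain ⟨u, hu, v, hv, rfl⟩ := Submodule.mem_sup.1 ha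
      rw [add_mul]
      exact add_mem (Submodule.mem_sup_left (hm.1.2.2.2 x u hu))
        (Submodule.mem_sup_right (hJ.2.2.2 x v hv))
  · intro h1
    apply hne
    rw [eq_top_iff]
    intro x _
    have : x ∈ (Set.univ : Set A) := trivial
    rw [← h1] at this
    exact this
  · intro x hx
    exact Submodule.mem_sup_left (S := auxSub R m hm.1) hx

theorem aux_rad_le {R A : Type*} [CommRing R] [IsLocalRing R] [Ring A] [Algebra R A]
    [Module.Finite R A] {m : Set A} (hm : IsMaximalTwoSidedIdeal m) :
    (maximalIdeal R • ⊤ : Submodule R A) ≤ auxSub R m hm.1 := by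
  by_contra h
  have := aux_sum (R := R) hm (maximalIdeal R • ⊤) ⟨zero_mem _, fun a ha b hb => add_mem ha hb,
    fun x a ha => aux_mul_mem_left _ _ ha, fun x a ha => aux_mul_mem_right _ _ ha⟩ h
  have h2 := Submodule.le_of_le_smul_of_le_jacobson_bot (Module.finite_def.mp ‹Module.Finite R A›)
    (maximalIdeal_le_jacobson _) this.ge
  exact aux_one_notMem hm.1 hm.2.1 (h2 (x := 1) trivial)

theorem aux_artinian (R A : Type*) [CommRing R] [IsLocalRing R] [AddCommGroup A] [Module R A]
    [Module.Finite R A] : IsArtinian R (A ⧸ (maximalIdeal R • ⊤ : Submodule R A)) := by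
  let _ : Field (R ⧸ maximalIdeal R) := Ideal.Quotient.field _
  have : Module.Finite (R ⧸ maximalIdeal R) (A ⧸ (maximalIdeal R • ⊤ : Submodule R A)) :=
    Module.Finite.of_restrictScalars_finite R _ _
  exact (isArtinian_of_surjective_algebraMap (S := R) (R := R ⧸ maximalIdeal R)
    (M := A ⧸ (maximalIdeal R • ⊤ : Submodule R A)) Ideal.Quotient.mk_surjective)

/-- Elements congruent to one modulo `m` and lying in all other maximal ideals. -/
theorem aux_sep {R A : Type*} [CommRing R] [IsLocalRing R] [Ring A] [Algebra R A]
    [Module.Finite R A] {m : Set A} (hm : IsMaximalTwoSidedIdeal m) :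
    ∃ x : A, x - 1 ∈ m ∧ ∀ m' : Set A, IsMaximalTwoSidedIdeal m' → m' ≠ m → x ∈ m' := by
  classical
  have := aux_artinian R A
  let T := {m' : Set A // IsMaximalTwoSidedIdeal m' ∧ m' ≠ m}
  let P : Submodule R A := maximalIdeal R • ⊤
  let g : T → Submodule R (A ⧸ P) := fun t => (auxSub R t.1 t.2.1.1).map P.mkQ
  obtain ⟨s, hs⟩ := Finset.exists_inf_le g
  have fin : ∀ s : Finset T, ∃ x : A, x - 1 ∈ m ∧ ∀ t ∈ s, x ∈ t.1 := by
    intro s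
    induction s using Finset.induction_on with
    | empty => exact ⟨1, by simpa using hm.1.1, by simp⟩
    | insert t s _ ih =>
      obtain ⟨x, hx, hxs⟩ := ih
      have htm : ¬ t.1 ⊆ m := fun h => t.2.2 (t.2.1.2.2 m hm.1 hm.2.1 h).symm
      have hsum := aux_sum (R := R) hm (auxSub R t.1 t.2.1.1) t.2.1.1 htm
      have h1 : (1 : A) ∈ auxSub R m hm.1 ⊔ auxSub R t.1 t.2.1.1 := hsum ▸ trivial
      obtain ⟨u, hu, v, hv, huv⟩ := Submodule.mem_sup.1 h1
      refine ⟨x * v, ?_, ?_⟩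
      · have e1 : x * v - 1 = (x - 1) * v + (-1) * u := by
          rw [eq_sub_of_add_eq' huv]; noncomm_ring
        rw [e1]
        exact hm.1.2.1 _ (hm.1.2.2.2 _ _ hx) _ (hm.1.2.2.1 _ _ hu)
      · intro t' ht'
        rcases Finset.mem_insert.1 ht' with rfl | h
        · exact t'.2.1.1.2.2.1 _ _ hv
        · exact t'.2.1.1.2.2.2 _ _ (hxs t' h)
  obtain ⟨x, hx, hxs⟩ := fin s
  refine ⟨x, hx, fun m' hm' hne => ?_⟩
  have h1 : P.mkQ x ∈ s.inf g := by
    rw [Submodule.mem_finsetInf]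
    exact fun t ht => Submodule.mem_map_of_mem (hxs t ht)
  obtain ⟨y, hy, hyx⟩ := hs ⟨m', hm', hne⟩ h1
  have h2 : x - y ∈ P := by
    rw [← Submodule.ker_mkQ P, LinearMap.mem_ker, map_sub, hyx, sub_self]
  have h3 := add_mem (aux_rad_le (R := R) hm' h2) hy
  rw [sub_add_cancel] at h3
  exact h3

theorem aux_fitting {R A : Type*} [CommRing R] [IsLocalRing R] [Ring A] [Algebra R A]
    [Module.Finite R A] (x : A) : ∃ (n : ℕ) (y : A), Commute x y ∧
      x ^ (n + 1) - x ^ (2 * (n + 1)) * y ∈ (maximalIdeal R • ⊤ : Submodule R A) := by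
  have := aux_artinian R A
  let P : Submodule R A := maximalIdeal R • ⊤
  let S : Submodule R A := Subalgebra.toSubmodule (Algebra.adjoin R {x})
  have hxS : x ∈ Algebra.adjoin R {x} := Algebra.subset_adjoin rfl
  let F : ℕ → Submodule R (A ⧸ P) := fun n =>
    (S.map (LinearMap.mulLeft R (x ^ n))).map P.mkQ
  have hF : Antitone F := by
    intro a b hab
    apply Submodule.map_mono
    rintro _ ⟨s, hs, rfl⟩
    refine ⟨x ^ (b - a) * s, mul_mem (S := Subalgebra R A) (pow_mem hxS _) hs, ?_⟩
    simp only [LinearMap.mulLeft_apply]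
    rw [← mul_assoc, ← pow_add, Nat.add_sub_cancel' hab]
  obtain ⟨n, hn⟩ := IsArtinian.monotone_stabilizes (⟨fun n => OrderDual.toDual (F n), fun a b h => hF h⟩ : ℕ →o (Submodule R (A ⧸ P))ᵒᵈ)
  have e : F (n + 1) = F (2 * (n + 1)) := 
    (hn (n+1) (by omega)).symm.trans (hn (2 * (n+1)) (by omega))
  have hmem : P.mkQ (x ^ (n + 1)) ∈ F (n + 1) :=
    Submodule.mem_map_of_mem ⟨1, one_mem (Algebra.adjoin R {x}), by simp⟩
  rw [e] at hmem
  obtain ⟨_, ⟨y, hy, rfl⟩, hyx⟩ := hmem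
  refine ⟨n, y, ?_, ?_⟩
  · exact Algebra.commute_of_mem_adjoin_self hy
  · rw [LinearMap.mulLeft_apply] at hyx
    change _ ∈ P
    rw [← Submodule.ker_mkQ P, LinearMap.mem_ker, map_sub, hyx, sub_self]

end Helpers

/-- Let `R` be a Noetherian commutative local ring which is complete with respect to its
maximal ideal, and let `A` be an `R`-algebra which is finitely generated as an
`R`-module. Then for any maximal two-sided ideal `m` of `A` there exists an idempotent
for `(A, m)`: an element `e` with `e² = e`, `e ∉ m`, and `e ∈ m'` for every maximal
two-sided ideal `m' ≠ m`. -/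
theorem exists_idempotent_for_maximal_twoSidedIdeal {R A : Type*} [CommRing R]
    [IsLocalRing R] [IsNoetherianRing R]
    [IsAdicComplete (IsLocalRing.maximalIdeal R) R]
    [Ring A] [Algebra R A] [Module.Finite R A]
    (m : Set A) (hm : IsMaximalTwoSidedIdeal m) :
    ∃ e : A, e * e = e ∧ e ∉ m ∧
      ∀ m' : Set A, IsMaximalTwoSidedIdeal m' → m' ≠ m → e ∈ m' := by
  obtain ⟨x, hx1, hx⟩ := aux_sep (R := R) hm
  obtain ⟨n, y, hc, hy⟩ := aux_fitting (R := R) x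
  have hcn : x ^ (n + 1) * y = y * x ^ (n + 1) := (hc.pow_left (n + 1)).eq
  obtain ⟨e, he, hae⟩ := aux_lift (R := R) (x ^ (n + 1) * y) (by
    have e1 : x ^ (n + 1) * y * (x ^ (n + 1) * y) - x ^ (n + 1) * y =
        - ((x ^ (n + 1) - x ^ (2 * (n + 1)) * y) * y) := by
      have : x ^ (n + 1) * y * (x ^ (n + 1) * y) = x ^ (2 * (n + 1)) * y * y := by
        rw [two_mul, pow_add x (n + 1) (n + 1), mul_assoc, ← mul_assoc y, ← hcn]
        simp only [mul_assoc]
      rw [this, sub_mul, neg_sub]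
    rw [e1]
    exact neg_mem (aux_mul_mem_right _ _ hy))
  refine ⟨e, he, ?_, ?_⟩
  · intro hem
    have hM : ∀ k, x ^ k - 1 ∈ auxSub R m hm.1 := by
      intro k
      induction k with
      | zero => simp
      | succ k ih =>
        have : x ^ (k + 1) - 1 = x ^ k * (x - 1) + (x ^ k - 1) := by
          rw [pow_succ]; noncomm_ring
        rw [this]
        exact add_mem (hm.1.2.2.1 _ _ hx1) ih
    have b1 : x ^ (n + 1) * y ∈ auxSub R m hm.1 := by
      have := add_mem (aux_rad_le (R := R) hm hae) (show e ∈ auxSub R m hm.1 from hem)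
      rwa [sub_add_cancel] at this
    have b2 : x ^ (2 * (n + 1)) * y ∈ auxSub R m hm.1 := by
      rw [two_mul, pow_add, mul_assoc]
      exact hm.1.2.2.1 _ _ b1
    have b3 := add_mem (aux_rad_le (R := R) hm hy) b2
    rw [sub_add_cancel] at b3
    have b4 := sub_mem b3 (hM (n + 1))
    rw [sub_sub_cancel] at b4
    exact aux_one_notMem hm.1 hm.2.1 b4
  · intro m' hm' hne
    have b1 : x ^ (n + 1) * y ∈ auxSub R m' hm'.1 := by
      rw [pow_succ]
      exact hm'.1.2.2.2 _ _ (hm'.1.2.2.1 _ _ (hx m' hm' hne))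
    have := sub_mem b1 (aux_rad_le (R := R) hm' hae)
    rw [sub_sub_cancel] at this
    exact this
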